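/- Every ℝ-linear map f from the quaternions to the quaternions can be written in the canonic form: there exist quaternions A, B, C, D such that f(q) = A·q + B·q·i + C·q·j + D·q·k for all quaternions q. -/

import Mathlib

open scoped Quaternion

/-- The imaginary units of the real quaternions. -/
def qi : ℍ[ℝ] := ⟨0, 1, 0, 0⟩
def qj : ℍ[ℝ] := ⟨0, 0, 1, 0⟩
def qk : ℍ[ℝ] := ⟨0, 0, 0, 1⟩

@[simp] theorem qi_re : qi.re = 0 := rfl
@[simp] theorem qi_imI : qi.imI = 1 := rfl
@[simp] theorem qi_imJ : qi.imJ = 0 := rfl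
@[simp] theorem qi_imK : qi.imK = 0 := rfl

@[simp] theorem qj_re : qj.re = 0 := rfl
@[simp] theorem qj_imI : qj.imI = 0 := rfl
@[simp] theorem qj_imJ : qj.imJ = 1 := rfl
@[simp] theorem qj_imK : qj.imK = 0 := rfl

@[simp] theorem qk_re : qk.re = 0 := rfl
@[simp] theorem qk_imI : qk.imI = 0 := rfl
@[simp] theorem qk_imJ : qk.imJ = 0 := rfl
@[simp] theorem qk_imK : qk.imK = 1 := rfl

/-- A linear map on the quaternions is determined by its values on `1`, `i`, `j`, `k`. -/
theorem map_quaternion_eq (f : ℍ[ℝ] →ₗ[ℝ] ℍ[ℝ]) (q : ℍ[ℝ]) :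
    f q = q.re • f 1 + q.imI • f qi + q.imJ • f qj + q.imK • f qk := by
  have h : q = q.re • (1 : ℍ[ℝ]) + q.imI • qi + q.imJ • qj + q.imK • qk := by
    ext <;> simp
  conv_lhs => rw [h]
  simp only [map_add, map_smul]

/-- every ℝ-linear map `ℍ → ℍ` can be written in the canonic form. -/
theorem stmt_7 (f : ℍ[ℝ] →ₗ[ℝ] ℍ[ℝ]) :
    ∃ A B C D : ℍ[ℝ], ∀ q : ℍ[ℝ],
      f q = A * q + B * q * qi + C * q * qj + D * q * qk := by
  refine ⟨(1 / 4 : ℝ) • (f 1 - f qi * qi - f qj * qj - f qk * qk),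
    (1 / 4 : ℝ) • (-(f 1 * qi) - f qi + f qj * qk - f qk * qj),
    (1 / 4 : ℝ) • (-(f 1 * qj) - f qi * qk - f qj + f qk * qi),
    (1 / 4 : ℝ) • (-(f 1 * qk) + f qi * qj - f qj * qi - f qk), fun q => ?_⟩
  rw [map_quaternion_eq f q]
  generalize f 1 = a, f qi = b, f qj = c, f qk = d
  ext <;> simp <;> ring
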